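/- arXiv:2008.09636 — 2 statements merged into one kernel-verified Lean document; each statement's English description precedes it below -/
import Mathlib

section
/- Let X be a topological space carrying a topological action r_1, …, r_{n−1} of TL_n(1). Let i_1 < i_2 < ⋯ < i_m and j_1 < j_2 < ⋯ < j_m be indices in {1,…,n−1} such that i_{k+1} − i_k ≥ 2 and j_{k+1} − j_k ≥ 2 for all k. Then the subspaces A_{i_1} ∩ A_{i_2} ∩ ⋯ ∩ A_{i_m} and A_{j_1} ∩ A_{j_2} ∩ ⋯ ∩ A_{j_m} of X (with the subspace topology) are homeomorphic. In particular, the homeomorphism class of a long-distance intersection depends only on the number of subspaces intersected. -/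
/-- A topological action of the Temperley–Lieb monoid `TL_n(1)` on a topological space
`X`: continuous maps `r 1, …, r (n-1) : X → X` satisfying the idempotent, neighbor and
long-distance Temperley–Lieb relations.  For each valid index `i`, `A_i` is the image
`Set.range (r i)`, which coincides with the fixed-point set of `r i`. -/
structure TLAction (n : ℕ) (X : Type*) [TopologicalSpace X] where
  r : ℕ → X → X
  continuous : ∀ i, 1 ≤ i → i ≤ n - 1 → Continuous (r i)
  idem : ∀ i, 1 ≤ i → i ≤ n - 1 → r i ∘ r i = r i
  neighbor₁ : ∀ i, 1 ≤ i → i + 1 ≤ n - 1 → r i ∘ r (i + 1) ∘ r i = r i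
  neighbor₂ : ∀ i, 1 ≤ i → i + 1 ≤ n - 1 → r (i + 1) ∘ r i ∘ r (i + 1) = r (i + 1)
  longdist : ∀ i j, 1 ≤ i → i ≤ n - 1 → 1 ≤ j → j ≤ n - 1 →
    (i + 2 ≤ j ∨ j + 2 ≤ i) → r i ∘ r j = r j ∘ r i

theorem TLaux_mem {n : ℕ} {X : Type*} [TopologicalSpace X] (A : TLAction n X) (m : ℕ)
    (ι : ℕ → ℕ) (h : ∀ k < m, 1 ≤ ι k ∧ ι k ≤ n - 1) (x : X) :
    x ∈ (⋂ k ∈ Finset.range m, Set.range (A.r (ι k))) ↔ ∀ k < m, A.r (ι k) x = x := by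
  simp only [Set.mem_iInter, Finset.mem_range]
  refine forall₂_congr fun k hk => ?_
  constructor
  · rintro ⟨y, rfl⟩
    exact congrFun (A.idem _ (h k hk).1 (h k hk).2) y
  · intro hx
    exact ⟨x, hx⟩

/-- Pairwise gaps from consecutive gaps. -/
theorem TLaux_gap (m : ℕ) (ι : ℕ → ℕ) (hg : ∀ k, k + 1 < m → ι k + 2 ≤ ι (k + 1))
    (a b : ℕ) (hab : a < b) (hb : b < m) : ι a + 2 ≤ ι b := by
  induction b with
  | zero => omega
  | succ b ih =>
    have h1 := hg b hb
    rcases Nat.lt_succ_iff_lt_or_eq.mp hab with h | h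
    · have := ih h (by omega)
      omega
    · subst h
      exact h1

/-- One elementary move: lowering one index by one. -/
theorem TLaux_step {n : ℕ} {X : Type*} [TopologicalSpace X] (A : TLAction n X) (m : ℕ)
    (ι ι' : ℕ → ℕ) (h : ∀ k < m, 1 ≤ ι k ∧ ι k ≤ n - 1)
    (h' : ∀ k < m, 1 ≤ ι' k ∧ ι' k ≤ n - 1)
    (k : ℕ) (hk : k < m) (hkk : ι k = ι' k + 1) (hne : ∀ l, l ≠ k → ι l = ι' l)
    (hfar : ∀ l < m, l ≠ k → ι l + 2 ≤ ι' k ∨ ι k + 2 ≤ ι l) :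
    Nonempty (↥(⋂ k ∈ Finset.range m, Set.range (A.r (ι k))) ≃ₜ
       ↥(⋂ k ∈ Finset.range m, Set.range (A.r (ι' k)))) := by
  have hv := h k hk
  have hv' := h' k hk
  have hmaps : ∀ x, (∀ l < m, A.r (ι l) x = x) →
      ∀ l < m, A.r (ι' l) (A.r (ι' k) x) = A.r (ι' k) x := by
    intro x hx l hl
    by_cases hlk : l = k
    · subst hlk
      exact congrFun (A.idem _ hv'.1 hv'.2) x
    · have h1 := congrFun (A.longdist (ι' l) (ι' k) (h' l hl).1 (h' l hl).2 hv'.1 hv'.2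
        (by have := hfar l hl hlk; have := hne l hlk; omega)) x
      have h2 := hx l hl
      rw [hne l hlk] at h2
      simp only [Function.comp] at h1
      rw [h1, h2]
  have hmaps' : ∀ x, (∀ l < m, A.r (ι' l) x = x) →
      ∀ l < m, A.r (ι l) (A.r (ι k) x) = A.r (ι k) x := by
    intro x hx l hl
    by_cases hlk : l = k
    · subst hlk
      exact congrFun (A.idem _ hv.1 hv.2) x
    · have h1 := congrFun (A.longdist (ι l) (ι k) (h l hl).1 (h l hl).2 hv.1 hv.2
        (by have := hfar l hl hlk; omega)) x
      have h2 := hx l hl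
      rw [← hne l hlk] at h2
      simp only [Function.comp] at h1
      rw [h1, h2]
  refine ⟨{ toFun := fun x => ⟨A.r (ι' k) x.1, (TLaux_mem A m ι' h' _).2
              (hmaps x.1 ((TLaux_mem A m ι h _).1 x.2))⟩
            invFun := fun x => ⟨A.r (ι k) x.1, (TLaux_mem A m ι h _).2
              (hmaps' x.1 ((TLaux_mem A m ι' h' _).1 x.2))⟩
            left_inv := ?_
            right_inv := ?_
            continuous_toFun := ?_
            continuous_invFun := ?_ }⟩
  · intro x
    apply Subtype.ext
    have hx := (TLaux_mem A m ι h _).1 x.2 k hk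
    have h1 := congrFun (A.neighbor₂ (ι' k) hv'.1 (by omega)) x.1
    rw [← hkk] at h1
    simp only [Function.comp, hx] at h1
    exact h1
  · intro x
    apply Subtype.ext
    have hx := (TLaux_mem A m ι' h' _).1 x.2 k hk
    have h1 := congrFun (A.neighbor₁ (ι' k) hv'.1 (by omega)) x.1
    rw [← hkk] at h1
    simp only [Function.comp, hx] at h1
    exact h1
  · exact ((A.continuous _ hv'.1 hv'.2).comp continuous_subtype_val).subtype_mk _
  · exact ((A.continuous _ hv.1 hv.2).comp continuous_subtype_val).subtype_mk _

/-- Every long-distance intersection is homeomorphic to the one with indices `1, 3, 5, …`. -/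
theorem TLaux_canon {n : ℕ} {X : Type*} [TopologicalSpace X] (A : TLAction n X) (m : ℕ)
    (s : ℕ) : ∀ (ι : ℕ → ℕ), (∀ k < m, 1 ≤ ι k ∧ ι k ≤ n - 1) →
    (∀ k, k + 1 < m → ι k + 2 ≤ ι (k + 1)) → ∑ k ∈ Finset.range m, ι k ≤ s →
    Nonempty (↥(⋂ k ∈ Finset.range m, Set.range (A.r (ι k))) ≃ₜ
       ↥(⋂ k ∈ Finset.range m, Set.range (A.r (2 * k + 1)))) := by
  induction s with
  | zero =>
    intro ι h hg hs
    rcases Nat.eq_zero_or_pos m with rfl | hm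
    · exact ⟨Homeomorph.setCongr (by simp)⟩
    · have h0 := Finset.single_le_sum (f := ι) (fun i _ => Nat.zero_le _)
        (Finset.mem_range.2 hm)
      have := h 0 hm
      omega
  | succ s ih =>
    intro ι h hg hs
    by_cases hall : ∀ k < m, ι k = 2 * k + 1
    · refine ⟨Homeomorph.setCongr ?_⟩
      refine Set.iInter₂_congr fun k hk => ?_
      rw [hall k (Finset.mem_range.1 hk)]
    · have hex : ∃ k, k < m ∧ ι k ≠ 2 * k + 1 := by
        push Not at hall
        exact hall
      classical
      obtain ⟨hk, hkne⟩ := Nat.find_spec hex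
      have hmin : ∀ l < Nat.find hex, ι l = 2 * l + 1 := by
        intro l hl
        by_contra hc
        exact Nat.find_min hex hl ⟨by omega, hc⟩
      generalize Nat.find hex = k at hk hkne hmin
      have hgt : 2 * k + 1 < ι k := by
        rcases Nat.eq_zero_or_pos k with rfl | hpos
        · have := h 0 hk
          omega
        · obtain ⟨j, rfl⟩ : ∃ j, k = j + 1 := ⟨k - 1, by omega⟩
          have h1 := hmin j (by omega)
          have h2 := hg j hk
          omega
      have hself : Function.update ι k (ι k - 1) k = ι k - 1 := Function.update_self ..
      have hoth : ∀ l, l ≠ k → Function.update ι k (ι k - 1) l = ι l :=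
        fun l hl => Function.update_of_ne hl ..
      generalize Function.update ι k (ι k - 1) = ι' at hself hoth
      have h' : ∀ l < m, 1 ≤ ι' l ∧ ι' l ≤ n - 1 := by
        intro l hl
        by_cases hlk : l = k
        · subst hlk
          have := h l hl
          omega
        · rw [hoth l hlk]
          exact h l hl
      have hg' : ∀ l, l + 1 < m → ι' l + 2 ≤ ι' (l + 1) := by
        intro l hl
        have h1 := hg l hl
        by_cases hlk : l = k
        · subst hlk
          rw [hself, hoth (l + 1) (by omega)]
          omega
        · rw [hoth l hlk]
          by_cases hlk' : l + 1 = k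
          · subst hlk'
            have := hmin l (by omega)
            omega
          · rw [hoth _ hlk']
            exact h1
      have hlt : ∑ l ∈ Finset.range m, ι' l < ∑ l ∈ Finset.range m, ι l := by
        refine Finset.sum_lt_sum (fun l _ => ?_) ⟨k, Finset.mem_range.2 hk, by omega⟩
        by_cases hlk : l = k
        · subst hlk
          omega
        · exact (hoth l hlk).le
      obtain ⟨e⟩ := TLaux_step A m ι ι' h h' k hk (by omega) (fun l hl => (hoth l hl).symm)
        (by
          intro l hl hlk
          rcases Nat.lt_or_gt_of_ne hlk with hl' | hl'
          · left
            have := hmin l hl'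
            omega
          · right
            exact TLaux_gap m ι hg k l hl' hl)
      obtain ⟨e'⟩ := ih ι' h' hg' (by omega)
      exact ⟨e.trans e'⟩

/-- (Long-distance intersections of the same cardinality are
homeomorphic.)  If `ι 0 < ⋯ < ι (m-1)` and `κ 0 < ⋯ < κ (m-1)` are two families of
indices in `{1, …, n-1}` with consecutive members differing by at least `2`, then the
subspaces `A_{ι 0} ∩ ⋯ ∩ A_{ι (m-1)}` and `A_{κ 0} ∩ ⋯ ∩ A_{κ (m-1)}` of `X` are
homeomorphic. -/
theorem longDistance_intersections_homeomorphic
    {n : ℕ} (hn : 2 ≤ n) {X : Type*} [TopologicalSpace X] (A : TLAction n X)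
    (m : ℕ) (hm : 1 ≤ m) (ι κ : ℕ → ℕ)
    (hιmem : ∀ k < m, 1 ≤ ι k ∧ ι k ≤ n - 1)
    (hιgap : ∀ k, k + 1 < m → ι k + 2 ≤ ι (k + 1))
    (hκmem : ∀ k < m, 1 ≤ κ k ∧ κ k ≤ n - 1)
    (hκgap : ∀ k, k + 1 < m → κ k + 2 ≤ κ (k + 1)) :
    Nonempty
      (↥(⋂ k ∈ Finset.range m, Set.range (A.r (ι k))) ≃ₜ
       ↥(⋂ k ∈ Finset.range m, Set.range (A.r (κ k)))) := by
  obtain ⟨e⟩ := TLaux_canon A m _ ι hιmem hιgap le_rfl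
  obtain ⟨e'⟩ := TLaux_canon A m _ κ hκmem hκgap le_rfl
  exact ⟨e.trans e'.symm⟩
end

section
/- Let M be a monoid, let k ≤ l be natural numbers, and let u_k, u_{k+1}, …, u_l be elements of M satisfying u_j · u_j = u_j for all k ≤ j ≤ l and u_j · u_{j+1} · u_j = u_j for all k ≤ j ≤ l−1. Then (u_k · u_{k+1} · ⋯ · u_l) · (u_l · u_{l−1} · ⋯ · u_k) = u_k. -/
/-- In a monoid `M`, if `u k, …, u l` satisfy the idempotent relations
`u j * u j = u j` (for `k ≤ j ≤ l`) and the neighbor relations `u j * u (j+1) * u j = u j`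
(for `k ≤ j < l`), then the ascending product `u k * u (k+1) * ⋯ * u l` times the
descending product `u l * u (l-1) * ⋯ * u k` equals `u k`. -/
theorem ascending_mul_descending_eq {M : Type*} [Monoid M]
    (k l : ℕ) (hkl : k ≤ l) (u : ℕ → M)
    (hidem : ∀ j, k ≤ j → j ≤ l → u j * u j = u j)
    (hneighbor : ∀ j, k ≤ j → j + 1 ≤ l → u j * u (j + 1) * u j = u j) :
    (((List.range' k (l - k + 1)).map u).prod) *
      (((List.range' k (l - k + 1)).reverse.map u).prod) = u k := by
  obtain ⟨n, rfl⟩ := Nat.exists_eq_add_of_le hkl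
  rw [Nat.add_sub_cancel_left]
  clear hkl
  induction n generalizing k with
  | zero => simpa using hidem k le_rfl le_rfl
  | succ n ih =>
    have h := ih (k + 1) (fun j h1 h2 => hidem j (by omega) (by omega))
      (fun j h1 h2 => hneighbor j (by omega) (by omega))
    have hk := hneighbor k le_rfl (by omega)
    rw [List.range'_succ, List.reverse_cons, List.map_append, List.prod_append,
      List.map_cons, List.prod_cons, List.map_singleton, List.prod_singleton,
      mul_assoc, ← mul_assoc (List.prod _) (List.prod _) (u k), h, ← mul_assoc, hk]
end
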